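/- (Lemma 2.1, case (h3)) Assume (h1), (h2) and (h3). Then for every q ∈ [2, 2*_α] there exists a constant C > 0 such that (∫_{ℝ^N} K(x)|u(x)|^q dx)^{1/q} ≤ C‖u‖ for every u ∈ X; that is, X is continuously embedded in the weighted Lebesgue space L^q_K(ℝ^N). -/

import Mathlib

open MeasureTheory Filter

noncomputable section

namespace ZeroMass

/-- The ambient Euclidean space `ℝ^N`. -/
abbrev EN (N : ℕ) := EuclideanSpace ℝ (Fin N)

/-- The critical fractional Sobolev exponent `2*_α = 2N/(N-2α)`. -/
def critExp (N : ℕ) (α : ℝ) : ℝ := 2 * N / (N - 2 * α)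

/-- The square of the Gagliardo seminorm `[u]²`. -/
def gagSq (N : ℕ) (α : ℝ) (u : EN N → ℝ) : ENNReal :=
  ∫⁻ p : EN N × EN N, ENNReal.ofReal ((u p.1 - u p.2) ^ 2 / ‖p.1 - p.2‖ ^ ((N : ℝ) + 2 * α))

/-- The square of the full norm `‖u‖² = [u]² + ∫ V u²`. -/
def normSq {N : ℕ} (α : ℝ) (V : EN N → ℝ) (u : EN N → ℝ) : ENNReal :=
  gagSq N α u + ∫⁻ x, ENNReal.ofReal (V x * u x ^ 2)

/-- Membership in the space `X`. -/
def memX {N : ℕ} (α : ℝ) (V : EN N → ℝ) (u : EN N → ℝ) : Prop :=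
  Measurable u ∧ normSq α V u < ⊤

/-- The norm of `X`, i.e. `‖u‖ = ([u]² + ∫ V u²)^{1/2}`. -/
def Xnorm {N : ℕ} (α : ℝ) (V : EN N → ℝ) (u : EN N → ℝ) : ℝ :=
  ((normSq α V u).toReal) ^ (1 / 2 : ℝ)

/-- The primitive `F(t) = ∫₀ᵗ f(τ) dτ`. -/
def prim (f : ℝ → ℝ) (t : ℝ) : ℝ := ∫ τ in (0 : ℝ)..t, f τ

/-- The energy functional `J`. -/
def Jfun {N : ℕ} (α : ℝ) (V K : EN N → ℝ) (f : ℝ → ℝ) (u : EN N → ℝ) : ℝ :=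
  (1 / 2) * (normSq α V u).toReal - ∫ x, K x * prim f (u x)

/-- The pairing `⟨J'(u), φ⟩`. -/
def Jd {N : ℕ} (α : ℝ) (V K : EN N → ℝ) (f : ℝ → ℝ) (u φ : EN N → ℝ) : ℝ :=
  (∫ p : EN N × EN N, (u p.1 - u p.2) * (φ p.1 - φ p.2) / ‖p.1 - p.2‖ ^ ((N : ℝ) + 2 * α))
    + (∫ x, V x * u x * φ x) - ∫ x, K x * f (u x) * φ x

/-- Positive part `u⁺ = max(u, 0)`. -/
def uplus {N : ℕ} (u : EN N → ℝ) : EN N → ℝ := fun x => max (u x) 0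

/-- Negative part `u⁻ = min(u, 0)`. -/
def uminus {N : ℕ} (u : EN N → ℝ) : EN N → ℝ := fun x => min (u x) 0

/-- `u` is not almost everywhere zero. -/
def NotAEZero {N : ℕ} (u : EN N → ℝ) : Prop :=
  ¬ (u =ᵐ[(volume : Measure (EN N))] (0 : EN N → ℝ))

/-- Hypothesis (h1): `V, K > 0` everywhere and `K` bounded. -/
def H1 {N : ℕ} (V K : EN N → ℝ) : Prop :=
  (∀ x, 0 < V x) ∧ (∀ x, 0 < K x) ∧ ∃ C : ℝ, ∀ x, K x ≤ C

/-- Hypothesis (h2): uniform vanishing of `∫_{A_n ∩ {|x| ≥ r}} K`. -/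
def H2 {N : ℕ} (K : EN N → ℝ) : Prop :=
  ∀ (A : ℕ → Set (EN N)) (R : ℝ), 0 < R → (∀ n, MeasurableSet (A n)) →
    (∀ n, volume (A n) ≤ ENNReal.ofReal R) →
    ∀ ε : ℝ, 0 < ε → ∃ r₀ : ℝ, ∀ r : ℝ, r₀ ≤ r → ∀ n,
      (∫⁻ x in A n ∩ {x : EN N | r ≤ ‖x‖}, ENNReal.ofReal (K x)) ≤ ENNReal.ofReal ε

/-- Hypothesis (h3): `K/V` is bounded. -/
def H3 {N : ℕ} (V K : EN N → ℝ) : Prop := ∃ C : ℝ, ∀ x, K x / V x ≤ C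

/-- Hypothesis (h4) with exponent `m`. -/
def H4 {N : ℕ} (α : ℝ) (V K : EN N → ℝ) (m : ℝ) : Prop :=
  2 < m ∧ m < critExp N α ∧
    Tendsto (fun x : EN N => K x / V x ^ ((critExp N α - m) / (critExp N α - 2)))
      (comap (fun x : EN N => ‖x‖) atTop) (nhds 0)

/-- Hypothesis (f1): `f(t)/|t| → 0` as `t → 0`. -/
def Cf1 (f : ℝ → ℝ) : Prop :=
  Tendsto (fun t : ℝ => f t / |t|) (nhdsWithin 0 {(0 : ℝ)}ᶜ) (nhds 0)

/-- Hypothesis (f̃1): `limsup_{t→0} f(t)/|t|^{m-1} < ∞`. -/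
def Cf1' (f : ℝ → ℝ) (m : ℝ) : Prop :=
  ∃ C : ℝ, ∀ᶠ t in nhdsWithin (0 : ℝ) {(0 : ℝ)}ᶜ, f t / |t| ^ (m - 1) ≤ C

/-- Hypothesis (f2) with exponent `p`: `f(t)/|t|^{p-1} → 0` as `|t| → ∞`. -/
def Cf2 (f : ℝ → ℝ) (p : ℝ) : Prop :=
  Tendsto (fun t : ℝ => f t / |t| ^ (p - 1)) (comap (fun t : ℝ => |t|) atTop) (nhds 0)

/-- Hypothesis (f3): `F(t)/t² → +∞` as `|t| → ∞`. -/
def Cf3 (f : ℝ → ℝ) : Prop :=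
  Tendsto (fun t : ℝ => prim f t / t ^ 2) (comap (fun t : ℝ => |t|) atTop) atTop

/-- Hypothesis (f4): `t ↦ f(t)/|t|` is strictly increasing on `ℝ \ {0}`. -/
def Cf4 (f : ℝ → ℝ) : Prop :=
  ∀ s t : ℝ, s ≠ 0 → t ≠ 0 → s < t → f s / |s| < f t / |t|

/-- Nehari manifold membership, formulated with the pairing `⟨J'(u), u⟩ = 0`. -/
def memNehari {N : ℕ} (α : ℝ) (V K : EN N → ℝ) (f : ℝ → ℝ) (u : EN N → ℝ) : Prop :=
  memX α V u ∧ NotAEZero u ∧ Jd α V K f u u = 0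

/-- Nehari manifold membership, formulated as `‖u‖² = ∫ K f(u) u`. -/
def memNehari2 {N : ℕ} (α : ℝ) (V K : EN N → ℝ) (f : ℝ → ℝ) (u : EN N → ℝ) : Prop :=
  memX α V u ∧ NotAEZero u ∧ (normSq α V u).toReal = ∫ x, K x * f (u x) * u x

/-- Nodal (sign-changing) Nehari set membership. -/
def memM {N : ℕ} (α : ℝ) (V K : EN N → ℝ) (f : ℝ → ℝ) (u : EN N → ℝ) : Prop :=
  memNehari α V K f u ∧ NotAEZero (uplus u) ∧ NotAEZero (uminus u) ∧
    Jd α V K f u (uplus u) = 0 ∧ Jd α V K f u (uminus u) = 0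

/-- Weak convergence in `X` of the sequence `u` to `w`. -/
def weakConv {N : ℕ} (α : ℝ) (V : EN N → ℝ) (u : ℕ → EN N → ℝ) (w : EN N → ℝ) : Prop :=
  ∀ v : EN N → ℝ, memX α V v →
    Tendsto (fun n =>
      (∫ p : EN N × EN N,
        ((u n p.1 - w p.1) - (u n p.2 - w p.2)) * (v p.1 - v p.2)
          / ‖p.1 - p.2‖ ^ ((N : ℝ) + 2 * α))
      + ∫ x, V x * (u n x - w x) * v x) atTop (nhds 0)

end ZeroMass

open ZeroMass

namespace ZeroMass

open Metric

/-- The normalized Lebesgue measure on a ball. -/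
def ballProb {N : ℕ} (x : EN N) (r : ℝ) : Measure (EN N) :=
  ProbabilityTheory.cond volume (ball x r)

/-- The Lebesgue measure of the unit ball. -/
def unitBallVol (N : ℕ) : ℝ := (volume (ball (0 : EN N) 1)).toReal

/-- The pointwise contribution to the Gagliardo seminorm. -/
def gagAt {N : ℕ} (α : ℝ) (u : EN N → ℝ) (x : EN N) : ENNReal :=
  ∫⁻ y, ENNReal.ofReal ((u x - u y) ^ 2 / ‖x - y‖ ^ ((N : ℝ) + 2 * α))

lemma unitBallVol_pos (N : ℕ) : 0 < unitBallVol N :=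
  ENNReal.toReal_pos (measure_ball_pos _ _ one_pos).ne' measure_ball_lt_top.ne

lemma volume_ball_eq {N : ℕ} (x : EN N) {r : ℝ} (hr : 0 < r) :
    volume (ball x r) = ENNReal.ofReal (r ^ (N : ℝ) * unitBallVol N) := by
  rw [Measure.addHaar_ball_of_pos volume x hr, ENNReal.ofReal_mul (by positivity), unitBallVol,
    ENNReal.ofReal_toReal measure_ball_lt_top.ne]
  simp

lemma isProbabilityMeasure_ballProb {N : ℕ} (x : EN N) {r : ℝ} (hr : 0 < r) :
    IsProbabilityMeasure (ballProb x r) :=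
  ProbabilityTheory.cond_isProbabilityMeasure_of_finite (measure_ball_pos _ _ hr).ne'
    measure_ball_lt_top.ne

lemma lintegral_ballProb {N : ℕ} (x : EN N) {r : ℝ} (hr : 0 < r) (f : EN N → ENNReal) :
    ∫⁻ y, f y ∂(ballProb x r) =
      ENNReal.ofReal (r ^ (N : ℝ) * unitBallVol N)⁻¹ * ∫⁻ y in ball x r, f y := by
  have := unitBallVol_pos N
  rw [ballProb, ProbabilityTheory.cond, lintegral_smul_measure, volume_ball_eq x hr,
    ENNReal.ofReal_inv_of_pos (by positivity), smul_eq_mul]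

lemma ofReal_sq_integral_sub_le {Ω : Type*} [MeasurableSpace Ω] {ν : Measure Ω}
    [IsProbabilityMeasure ν] {f : Ω → ℝ} (hf : Integrable f ν) (c : ℝ) :
    ENNReal.ofReal (((∫ y, f y ∂ν) - c) ^ 2) ≤ ∫⁻ y, ENNReal.ofReal ((f y - c) ^ 2) ∂ν := by
  have hfc : Integrable (fun y => f y - c) ν := hf.sub (integrable_const c)
  have e1 : (∫ y, f y ∂ν) - c = ∫ y, (f y - c) ∂ν := by
    rw [integral_sub hf (integrable_const c)]; simp
  have h1 := eLpNorm_le_eLpNorm_of_exponent_le (p := 1) (q := 2) (by norm_num)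
    hfc.aestronglyMeasurable
  have h2 := enorm_integral_le_lintegral_enorm (μ := ν) (fun y => f y - c)
  rw [eLpNorm_one_eq_lintegral_enorm,
    eLpNorm_eq_lintegral_rpow_enorm_toReal (by norm_num) (by norm_num)] at h1
  have h3 := ENNReal.rpow_le_rpow (h2.trans h1) (z := 2) (by norm_num)
  rw [← ENNReal.rpow_mul] at h3
  norm_num at h3
  have key : ∀ t : ℝ, ENNReal.ofReal (t ^ 2) = ‖t‖ₑ ^ 2 := fun t => by
    rw [← sq_abs, ENNReal.ofReal_pow (abs_nonneg t), ← Real.norm_eq_abs, ofReal_norm]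
  rw [e1]
  simpa only [key] using h3

lemma measurable_gagliardo_quotient {N : ℕ} (α : ℝ) {u : EN N → ℝ} (hu : Measurable u) :
    Measurable fun p : EN N × EN N =>
      ENNReal.ofReal ((u p.1 - u p.2) ^ 2 / ‖p.1 - p.2‖ ^ ((N : ℝ) + 2 * α)) := by
  fun_prop

lemma lintegral_gagAt {N : ℕ} (α : ℝ) {u : EN N → ℝ} (hu : Measurable u) :
    ∫⁻ x, gagAt α u x = gagSq N α u := by
  rw [gagSq, Measure.volume_eq_prod,
    lintegral_prod _ (measurable_gagliardo_quotient α hu).aemeasurable]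
  rfl

lemma setLIntegral_sq_sub_le {N : ℕ} {α : ℝ} (hα : 0 < α) (u : EN N → ℝ) (x z : EN N) {r L : ℝ}
    (h : dist x z + r ≤ L) :
    ∫⁻ y in ball z r, ENNReal.ofReal ((u y - u x) ^ 2) ≤
      ENNReal.ofReal (L ^ ((N : ℝ) + 2 * α)) * gagAt α u x := by
  rw [gagAt, ← lintegral_const_mul' _ _ ENNReal.ofReal_ne_top]
  refine (setLIntegral_mono' measurableSet_ball fun y hy => ?_).trans
    (setLIntegral_le_lintegral (ball z r) _)
  rw [← ENNReal.ofReal_mul' (by positivity)]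
  apply ENNReal.ofReal_le_ofReal
  rcases eq_or_ne x y with rfl | hxy
  · simp
  have hd : 0 < ‖x - y‖ := norm_pos_iff.2 (sub_ne_zero.2 hxy)
  have hle : ‖x - y‖ ≤ L := by
    rw [← dist_eq_norm]
    have := dist_triangle_right x y z
    have := mem_ball.1 hy
    linarith
  rw [mul_div_assoc', le_div_iff₀ (by positivity), mul_comm, ← neg_sub (u x), neg_sq]
  gcongr

lemma ofReal_sq_sub_mean_le {N : ℕ} {α : ℝ} (hα : 0 < α) {u : EN N → ℝ} (x z : EN N) {r L : ℝ}
    (hr : 0 < r) (hint : Integrable u (ballProb z r)) (h : dist x z + r ≤ L) :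
    ENNReal.ofReal (((∫ y, u y ∂(ballProb z r)) - u x) ^ 2) ≤
      ENNReal.ofReal (L ^ ((N : ℝ) + 2 * α) / (r ^ (N : ℝ) * unitBallVol N)) * gagAt α u x := by
  have := isProbabilityMeasure_ballProb z hr
  have hω := unitBallVol_pos N
  refine (ofReal_sq_integral_sub_le hint (u x)).trans ?_
  rw [lintegral_ballProb z hr, div_eq_inv_mul, ENNReal.ofReal_mul (by positivity), mul_assoc]
  gcongr
  exact setLIntegral_sq_sub_le hα u x z h

lemma ofReal_sq_mean_sub_mean_le {N : ℕ} {α : ℝ} (hα : 0 < α) {u : EN N → ℝ} (hu : Measurable u)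
    (x z : EN N) {r t L : ℝ} (hr : 0 < r) (ht : 0 < t) (hx : Integrable u (ballProb x r))
    (hz : Integrable u (ballProb z t)) (h : dist x z + r + t ≤ L) :
    ENNReal.ofReal (((∫ y, u y ∂(ballProb x r)) - ∫ y, u y ∂(ballProb z t)) ^ 2) ≤
      ENNReal.ofReal (L ^ ((N : ℝ) + 2 * α) /
        ((r ^ (N : ℝ) * unitBallVol N) * (t ^ (N : ℝ) * unitBallVol N))) * gagSq N α u := by
  have := isProbabilityMeasure_ballProb x hr
  have hω := unitBallVol_pos N
  have hL : 0 ≤ L := by have := dist_nonneg (x := x) (y := z); linarith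
  refine (ofReal_sq_integral_sub_le hx _).trans ?_
  rw [lintegral_ballProb x hr, div_mul_eq_div_div_swap, div_eq_inv_mul _ (r ^ (N : ℝ) * _),
    ENNReal.ofReal_mul (by positivity), mul_assoc, ← lintegral_gagAt α hu]
  refine mul_le_mul_right ?_ _
  rw [← lintegral_const_mul' _ _ ENNReal.ofReal_ne_top]
  refine (setLIntegral_mono' measurableSet_ball fun y hy => ?_).trans
    (setLIntegral_le_lintegral (ball x r) _)
  rw [← neg_sub, neg_sq]
  refine ofReal_sq_sub_mean_le hα y z ht hz ?_
  have := dist_triangle y x z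
  have := mem_ball.1 hy
  linarith

/-- Means over balls of comparable radii `ρ` differ by `O(ρ ^ (-(N - 2α) / 2))`. -/
lemma exists_abs_mean_sub_mean_le (N : ℕ) {α : ℝ} (hα : 0 < α) {a b l : ℝ} (ha : 0 < a)
    (hb : 0 < b) (hl : 0 < l) :
    ∃ D : ℝ, 0 < D ∧ ∀ (u : EN N → ℝ) (s : ℝ), 0 < s → Measurable u →
      (∀ (x : EN N) (r : ℝ), 0 < r → Integrable u (ballProb x r)) →
      gagSq N α u ≤ ENNReal.ofReal (s ^ 2) →
      ∀ (ρ : ℝ) (x z : EN N), 0 < ρ → dist x z + a * ρ + b * ρ ≤ l * ρ →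
        |(∫ y, u y ∂(ballProb x (a * ρ))) - ∫ y, u y ∂(ballProb z (b * ρ))| ≤
          D * ρ ^ (-((N - 2 * α) / 2)) * s := by
  have hω := unitBallVol_pos N
  set M : ℝ := l ^ ((N : ℝ) + 2 * α) /
    ((a ^ (N : ℝ) * unitBallVol N) * (b ^ (N : ℝ) * unitBallVol N)) with hM
  have hMpos : 0 < M := by positivity
  refine ⟨√M, by positivity, fun u s hs hu hint hG ρ x z hρ h => ?_⟩
  have h1 := ofReal_sq_mean_sub_mean_le hα hu x z (mul_pos ha hρ) (mul_pos hb hρ)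
    (hint _ _ (mul_pos ha hρ)) (hint _ _ (mul_pos hb hρ)) h
  have h2 := h1.trans (mul_le_mul_right hG _)
  rw [← ENNReal.ofReal_mul (by positivity), ENNReal.ofReal_le_ofReal_iff (by positivity)] at h2
  refine abs_le_of_sq_le_sq (h2.trans (le_of_eq ?_)) (by positivity)
  rw [mul_pow, mul_pow, Real.sq_sqrt hMpos.le, hM, ← Real.rpow_mul_natCast hρ.le,
    Real.mul_rpow hl.le hρ.le, Real.mul_rpow ha.le hρ.le, Real.mul_rpow hb.le hρ.le]
  have e : ρ ^ (-(((N : ℝ) - 2 * α) / 2) * (2 : ℕ)) =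
      ρ ^ ((N : ℝ) + 2 * α) / (ρ ^ (N : ℝ) * ρ ^ (N : ℝ)) := by
    rw [← Real.rpow_add hρ, ← Real.rpow_sub hρ]
    congr 1
    push_cast
    ring
  rw [e]
  field_simp

/-- The means over balls converge to a constant as the radius grows, with a rate that is uniform in
the centre. -/
lemma exists_abs_mean_sub_const_le {N : ℕ} {α : ℝ} (hα : 0 < α) (hN : 2 * α < N) :
    ∃ B : ℝ, 0 < B ∧ ∀ (u : EN N → ℝ) (s : ℝ), 0 < s → Measurable u →
      (∀ (x : EN N) (r : ℝ), 0 < r → Integrable u (ballProb x r)) →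
      gagSq N α u ≤ ENNReal.ofReal (s ^ 2) →
      ∃ c : ℝ, ∀ (x : EN N) (r : ℝ), 0 < r →
        |(∫ y, u y ∂(ballProb x r)) - c| ≤ B * r ^ (-((N - 2 * α) / 2)) * s := by
  obtain ⟨D, hD, H⟩ := exists_abs_mean_sub_mean_le N hα (a := 1) (b := 2) (l := 3)
    (by norm_num) (by norm_num) (by norm_num)
  set β : ℝ := ((N : ℝ) - 2 * α) / 2 with hβ
  have hβpos : 0 < β := by rw [hβ]; linarith
  set q : ℝ := (2 : ℝ) ^ (-β) with hq
  have hq0 : 0 < q := by positivity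
  have hq1 : q < 1 := Real.rpow_lt_one_of_one_lt_of_neg (by norm_num) (by linarith)
  have hpow : ∀ k : ℕ, ((2 : ℝ) ^ k) ^ (-β) = q ^ k := fun k =>
    (Real.rpow_pow_comm (by norm_num) _ _).symm
  refine ⟨D / (1 - q), div_pos hD (by linarith), fun u s hs hu hint hG => ?_⟩
  have step : ∀ (x : EN N) (r : ℝ), 0 < r → ∀ k : ℕ,
      dist (∫ y, u y ∂(ballProb x (r * 2 ^ k))) (∫ y, u y ∂(ballProb x (r * 2 ^ (k + 1)))) ≤
        D * r ^ (-β) * s * q ^ k := fun x r hr k => by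
    have := H u s hs hu hint hG (r * 2 ^ k) x x (by positivity) (by rw [dist_self]; linarith)
    rw [Real.mul_rpow hr.le (by positivity), hpow, one_mul] at this
    rw [Real.dist_eq]
    convert this using 1
    · ring_nf
    · ring
  obtain ⟨c, hc⟩ := cauchySeq_tendsto_of_complete
    (cauchySeq_of_le_geometric q _ hq1 (step 0 1 one_pos))
  refine ⟨c, fun x r hr => ?_⟩
  have hlim : Tendsto (fun k : ℕ => ∫ y, u y ∂(ballProb x (r * 2 ^ k))) atTop (nhds c) := by
    obtain ⟨D', hD', H'⟩ := exists_abs_mean_sub_mean_le N hα (a := r) (b := 1)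
      (l := ‖x‖ + r + 1) hr one_pos (by positivity)
    have hdiff : Tendsto (fun k : ℕ => (∫ y, u y ∂(ballProb x (r * 2 ^ k))) -
        ∫ y, u y ∂(ballProb (0 : EN N) (1 * 2 ^ k))) atTop (nhds 0) := by
      refine squeeze_zero_norm (a := fun k : ℕ => D' * q ^ k * s) (fun k => ?_) ?_
      · have h1 : (1 : ℝ) ≤ 2 ^ k := one_le_pow₀ (by norm_num)
        have := H' u s hs hu hint hG (2 ^ k) x 0 (by positivity)
          (by rw [dist_zero_right]; nlinarith [norm_nonneg x])
        rwa [← hβ, hpow] at this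
      · simpa using ((tendsto_pow_atTop_nhds_zero_of_lt_one hq0.le hq1).const_mul D').mul_const s
    simpa using hdiff.add hc
  have := dist_le_of_le_geometric_of_tendsto₀ q _ hq1 (step x r hr) hlim
  rw [Real.dist_eq, pow_zero, mul_one] at this
  refine this.trans (le_of_eq ?_)
  ring

lemma exists_ofReal_rpow_le {A B α β : ℝ} (hA : 0 < A) (hB : 0 < B) (hα : 0 < α) (hβ : 0 < β) :
    ∃ C : ℝ, 0 < C ∧ ∀ (s t : ℝ) (Γ : ENNReal), 0 < s → 0 ≤ t →
      (∀ r : ℝ, 0 < r → ∃ d e : ℝ, t ≤ d + e ∧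
        ENNReal.ofReal (d ^ 2) ≤ ENNReal.ofReal (A * r ^ (2 * α)) * Γ ∧ e ≤ B * r ^ (-β) * s) →
      ENNReal.ofReal (t ^ (2 + 2 * α / β)) ≤ ENNReal.ofReal (C * s ^ (2 * α / β)) * Γ := by
  refine ⟨4 * A * (2 * B) ^ (2 * α / β), by positivity, fun s t Γ hs ht h => ?_⟩
  rcases ht.eq_or_lt with rfl | ht
  · rw [Real.zero_rpow (by positivity)]
    simp
  obtain ⟨d, e, hde, hd, he⟩ := h ((2 * B * s / t) ^ (1 / β)) (by positivity)
  have e1 : ((2 * B * s / t) ^ (1 / β)) ^ (-β) = t / (2 * B * s) := by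
    rw [← Real.rpow_mul (by positivity), one_div, mul_neg, inv_mul_cancel₀ hβ.ne',
      Real.rpow_neg_one, inv_div]
  have e2 : ((2 * B * s / t) ^ (1 / β)) ^ (2 * α) =
      (2 * B) ^ (2 * α / β) * s ^ (2 * α / β) / t ^ (2 * α / β) := by
    rw [← Real.rpow_mul (by positivity), Real.div_rpow (by positivity) ht.le,
      Real.mul_rpow (by positivity) hs.le]
    ring_nf
  rw [e1] at he
  rw [e2] at hd
  have e3 : B * (t / (2 * B * s)) * s = t / 2 := by field_simp
  have hd2 : (t / 2) ^ 2 ≤ d ^ 2 := pow_le_pow_left₀ (by positivity) (by linarith) 2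
  have hfin := mul_le_mul_right ((ENNReal.ofReal_le_ofReal hd2).trans hd)
    (ENNReal.ofReal (4 * t ^ (2 * α / β)))
  rw [← mul_assoc, ← ENNReal.ofReal_mul (by positivity), ← ENNReal.ofReal_mul (by positivity)]
    at hfin
  have hT : 0 < t ^ (2 * α / β) := by positivity
  refine le_trans (le_of_eq ?_) (hfin.trans (le_of_eq ?_))
  · rw [Real.rpow_add ht, Real.rpow_two]
    ring_nf
  · congr 2
    field_simp

lemma critExp_eq {N : ℕ} {α : ℝ} (hN : 2 * α < N) :
    critExp N α = 2 + 2 * α / (((N : ℝ) - 2 * α) / 2) := by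
  have : (N : ℝ) - 2 * α ≠ 0 := by linarith
  rw [critExp]
  field_simp
  ring

lemma two_lt_critExp {N : ℕ} {α : ℝ} (hα : 0 < α) (hN : 2 * α < N) : 2 < critExp N α := by
  rw [critExp_eq hN]
  have : 0 < ((N : ℝ) - 2 * α) / 2 := by linarith
  have : 0 < 2 * α / (((N : ℝ) - 2 * α) / 2) := by positivity
  linarith

/-- The fractional Sobolev inequality modulo constants. -/
lemma exists_lintegral_abs_sub_rpow_le {N : ℕ} {α : ℝ} (hα : 0 < α) (hN : 2 * α < N) :
    ∃ C : ℝ, 0 < C ∧ ∀ (u : EN N → ℝ) (s : ℝ), 0 < s → Measurable u →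
      (∀ (x : EN N) (r : ℝ), 0 < r → Integrable u (ballProb x r)) →
      gagSq N α u ≤ ENNReal.ofReal (s ^ 2) →
      ∃ c : ℝ, |(∫ y, u y ∂(ballProb (0 : EN N) 1)) - c| ≤ C * s ∧
        ∫⁻ x, ENNReal.ofReal (|u x - c| ^ critExp N α) ≤
          ENNReal.ofReal (C * s ^ critExp N α) := by
  obtain ⟨B, hB, H⟩ := exists_abs_mean_sub_const_le hα hN
  have hω := unitBallVol_pos N
  have hβ : 0 < ((N : ℝ) - 2 * α) / 2 := by linarith
  obtain ⟨C, hC, HC⟩ := exists_ofReal_rpow_le (A := (unitBallVol N)⁻¹) (by positivity) hB hα hβ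
  refine ⟨max B C, by positivity, fun u s hs hu hint hG => ?_⟩
  obtain ⟨c, hc⟩ := H u s hs hu hint hG
  refine ⟨c, ?_, ?_⟩
  · refine (hc 0 1 one_pos).trans ?_
    rw [Real.one_rpow, mul_one]
    gcongr
    exact le_max_left _ _
  have hpt : ∀ x, ENNReal.ofReal (|u x - c| ^ critExp N α) ≤
      ENNReal.ofReal (C * s ^ (2 * α / (((N : ℝ) - 2 * α) / 2))) * gagAt α u x := fun x => by
    rw [critExp_eq hN]
    refine HC s _ _ hs (abs_nonneg _) fun r hr =>
      ⟨|u x - ∫ y, u y ∂(ballProb x r)|, |(∫ y, u y ∂(ballProb x r)) - c|,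
        abs_sub_le _ _ _, ?_, hc x r hr⟩
    have := ofReal_sq_sub_mean_le hα x x (L := r) hr (hint x r hr) (by simp)
    rw [sq_abs, ← neg_sub, neg_sq]
    convert this using 3
    rw [Real.rpow_add hr]
    field_simp
  calc ∫⁻ x, ENNReal.ofReal (|u x - c| ^ critExp N α)
      ≤ ENNReal.ofReal (C * s ^ (2 * α / (((N : ℝ) - 2 * α) / 2))) * gagSq N α u := by
        rw [← lintegral_gagAt α hu, ← lintegral_const_mul' _ _ ENNReal.ofReal_ne_top]
        exact lintegral_mono hpt
    _ ≤ ENNReal.ofReal (C * s ^ (2 * α / (((N : ℝ) - 2 * α) / 2))) * ENNReal.ofReal (s ^ 2) := by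
        gcongr
    _ = ENNReal.ofReal (C * s ^ critExp N α) := by
        rw [← ENNReal.ofReal_mul (by positivity), critExp_eq hN, Real.rpow_add hs, Real.rpow_two]
        ring_nf
    _ ≤ _ := by
        gcongr
        exact le_max_right _ _

lemma exists_pos_forall_ball_le {N : ℕ} {V : EN N → ℝ} (hV : Continuous V) (hpos : ∀ x, 0 < V x)
    (x : EN N) {r : ℝ} (hr : 0 < r) : ∃ v : ℝ, 0 < v ∧ ∀ y ∈ ball x r, v ≤ V y := by
  obtain ⟨z, -, hz⟩ := (isCompact_closedBall x r).exists_isMinOn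
    ⟨x, mem_closedBall_self hr.le⟩ hV.continuousOn
  exact ⟨V z, hpos z, fun y hy => hz (ball_subset_closedBall hy)⟩

lemma exists_lintegral_ballProb_sq_le {N : ℕ} {V : EN N → ℝ} (hV : Continuous V)
    (hpos : ∀ x, 0 < V x) (x : EN N) {r : ℝ} (hr : 0 < r) :
    ∃ M : ℝ, 0 < M ∧ ∀ u : EN N → ℝ, ∫⁻ y, ENNReal.ofReal (u y ^ 2) ∂(ballProb x r) ≤
      ENNReal.ofReal M * ∫⁻ y, ENNReal.ofReal (V y * u y ^ 2) := by
  obtain ⟨v, hv, hvV⟩ := exists_pos_forall_ball_le hV hpos x hr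
  have hω := unitBallVol_pos N
  refine ⟨(r ^ (N : ℝ) * unitBallVol N)⁻¹ * v⁻¹, by positivity, fun u => ?_⟩
  rw [lintegral_ballProb x hr, ENNReal.ofReal_mul (by positivity), mul_assoc]
  refine mul_le_mul_right ?_ _
  rw [← lintegral_const_mul' _ _ ENNReal.ofReal_ne_top]
  refine (setLIntegral_mono' measurableSet_ball fun y hy => ?_).trans
    (setLIntegral_le_lintegral (ball x r) _)
  rw [← ENNReal.ofReal_mul (by positivity)]
  apply ENNReal.ofReal_le_ofReal
  rw [← mul_assoc]
  refine le_mul_of_one_le_left (sq_nonneg _) ?_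
  rw [inv_mul_eq_div, le_div_iff₀ hv, one_mul]
  exact hvV y hy

lemma integrable_ballProb {N : ℕ} {V : EN N → ℝ} (hV : Continuous V) (hpos : ∀ x, 0 < V x)
    {u : EN N → ℝ} (hu : Measurable u) (hfin : ∫⁻ y, ENNReal.ofReal (V y * u y ^ 2) < ⊤)
    (x : EN N) {r : ℝ} (hr : 0 < r) : Integrable u (ballProb x r) := by
  have := isProbabilityMeasure_ballProb x hr
  obtain ⟨M, -, hM⟩ := exists_lintegral_ballProb_sq_le hV hpos x hr
  have hsq : Integrable (fun y => u y ^ 2) (ballProb x r) := by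
    refine ⟨(hu.pow_const 2).aestronglyMeasurable, ?_⟩
    rw [hasFiniteIntegral_iff_ofReal (ae_of_all _ fun y => sq_nonneg (u y))]
    exact (hM u).trans_lt (ENNReal.mul_lt_top ENNReal.ofReal_lt_top hfin)
  exact ((memLp_two_iff_integrable_sq hu.aestronglyMeasurable).2 hsq).integrable (by norm_num)

/-- If `u` is close to a nonzero constant while `∫ K u² < ∞`, then `K` is integrable. -/
lemma lintegral_lt_top_of_ne_zero {N : ℕ} {K u : EN N → ℝ} {k c p : ℝ} (hK : Measurable K)
    (hu : Measurable u) (hK0 : ∀ x, 0 < K x) (hk : ∀ x, K x ≤ k) (hp : 0 < p) (hc : c ≠ 0)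
    (h2 : ∫⁻ x, ENNReal.ofReal (K x * u x ^ 2) < ⊤)
    (hsub : ∫⁻ x, ENNReal.ofReal (|u x - c| ^ p) < ⊤) :
    ∫⁻ x, ENNReal.ofReal (K x) < ⊤ := by
  have hc' : 0 < |c| := abs_pos.2 hc
  have hk0 : 0 < k := (hK0 0).trans_le (hk 0)
  have hpt : ∀ x, ENNReal.ofReal (K x) ≤
      ENNReal.ofReal (4 / c ^ 2) * ENNReal.ofReal (K x * u x ^ 2) +
        ENNReal.ofReal (k * (2 / |c|) ^ p) * ENNReal.ofReal (|u x - c| ^ p) := fun x => by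
    have hKx := hK0 x
    rw [← ENNReal.ofReal_mul (by positivity), ← ENNReal.ofReal_mul (by positivity),
      ← ENNReal.ofReal_add (by positivity) (by positivity)]
    apply ENNReal.ofReal_le_ofReal
    rcases le_total (|c| / 2) |u x| with h | h
    · refine le_add_of_le_of_nonneg ?_ (by positivity)
      have : c ^ 2 / 4 ≤ u x ^ 2 := by
        rw [← sq_abs c, ← sq_abs (u x)]
        nlinarith
      rw [div_mul_eq_mul_div, le_div_iff₀ (by positivity)]
      nlinarith
    · refine le_add_of_nonneg_of_le (by positivity) ((hk x).trans ?_)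
      rw [mul_assoc, ← Real.mul_rpow (by positivity) (abs_nonneg _)]
      refine le_mul_of_one_le_right hk0.le (Real.one_le_rpow ?_ hp.le)
      rw [div_mul_eq_mul_div, le_div_iff₀ hc']
      have := abs_sub_abs_le_abs_sub c (u x)
      rw [abs_sub_comm] at this
      linarith
  refine (lintegral_mono hpt).trans_lt ?_
  rw [lintegral_add_left (by fun_prop), lintegral_const_mul' _ _ ENNReal.ofReal_ne_top,
    lintegral_const_mul' _ _ ENNReal.ofReal_ne_top]
  exact ENNReal.add_lt_top.2 ⟨ENNReal.mul_lt_top ENNReal.ofReal_lt_top h2,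
    ENNReal.mul_lt_top ENNReal.ofReal_lt_top hsub⟩

lemma add_rpow_le {a b p : ℝ} (ha : 0 ≤ a) (hb : 0 ≤ b) (hp : 0 < p) :
    (a + b) ^ p ≤ 2 ^ p * (a ^ p + b ^ p) := by
  have ha' : 0 ≤ a ^ p := by positivity
  have hb' : 0 ≤ b ^ p := by positivity
  rcases le_total a b with h | h
  · calc (a + b) ^ p ≤ (2 * b) ^ p := by gcongr; linarith
      _ = 2 ^ p * b ^ p := Real.mul_rpow (by norm_num) hb
      _ ≤ _ := by gcongr; linarith
  · calc (a + b) ^ p ≤ (2 * a) ^ p := by gcongr; linarith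
      _ = 2 ^ p * a ^ p := Real.mul_rpow (by norm_num) ha
      _ ≤ _ := by gcongr; linarith

lemma rpow_le_interpolation {s t q p : ℝ} (hs : 0 < s) (ht : 0 ≤ t) (hq : 2 ≤ q) (hqp : q ≤ p) :
    t ^ q ≤ s ^ (q - 2) * t ^ 2 + s ^ (q - p) * t ^ p := by
  rcases ht.eq_or_lt with rfl | ht
  · rw [Real.zero_rpow (by linarith)]
    positivity
  rcases le_total t s with h | h
  · refine le_add_of_le_of_nonneg ?_ (by positivity)
    calc t ^ q = t ^ (q - 2) * t ^ 2 := by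
          rw [← Real.rpow_two, ← Real.rpow_add ht, sub_add_cancel]
      _ ≤ _ := by
          gcongr
  · refine le_add_of_nonneg_of_le (by positivity) ?_
    calc t ^ q = t ^ (q - p) * t ^ p := by rw [← Real.rpow_add ht, sub_add_cancel]
      _ ≤ _ := by
          exact mul_le_mul_of_nonneg_right
            (Real.rpow_le_rpow_of_nonpos hs h (by linarith)) (by positivity)

/-- The weighted estimate at exponent `2`. -/
lemma exists_lintegral_mul_sq_le {N : ℕ} {α : ℝ} {V K : EN N → ℝ} (h1 : H1 V K) (h3 : H3 V K) :
    ∃ C : ℝ, 0 < C ∧ ∀ (u : EN N → ℝ) (s : ℝ), normSq α V u ≤ ENNReal.ofReal (s ^ 2) →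
      ∫⁻ x, ENNReal.ofReal (K x * u x ^ 2) ≤ ENNReal.ofReal (C * s ^ 2) := by
  obtain ⟨hV, hK, -⟩ := h1
  obtain ⟨C, hC⟩ := h3
  have hC0 : 0 < C := (div_pos (hK 0) (hV 0)).trans_le (hC 0)
  refine ⟨C, hC0, fun u s hs => ?_⟩
  calc ∫⁻ x, ENNReal.ofReal (K x * u x ^ 2)
      ≤ ENNReal.ofReal C * ∫⁻ x, ENNReal.ofReal (V x * u x ^ 2) := by
        rw [← lintegral_const_mul' _ _ ENNReal.ofReal_ne_top]
        refine lintegral_mono fun x => ?_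
        rw [← ENNReal.ofReal_mul hC0.le, ← mul_assoc]
        gcongr
        exact (div_le_iff₀ (hV x)).1 (hC x)
    _ ≤ ENNReal.ofReal C * ENNReal.ofReal (s ^ 2) := by
        gcongr
        exact le_add_self.trans hs
    _ = _ := (ENNReal.ofReal_mul hC0.le).symm

/-- The weighted estimate at the critical exponent. -/
lemma exists_lintegral_mul_rpow_critExp_le {N : ℕ} {α : ℝ} (hα : 0 < α) (hN : 2 * α < N)
    {V K : EN N → ℝ} (hV : Continuous V) (hK : Continuous K) (h1 : H1 V K) (h3 : H3 V K) :
    ∃ C : ℝ, 0 < C ∧ ∀ (u : EN N → ℝ) (s : ℝ), 0 < s → Measurable u →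
      normSq α V u ≤ ENNReal.ofReal (s ^ 2) →
      ∫⁻ x, ENNReal.ofReal (K x * |u x| ^ critExp N α) ≤
        ENNReal.ofReal (C * s ^ critExp N α) := by
  obtain ⟨C₂, -, H₂⟩ := exists_lintegral_mul_sq_le (α := α) h1 h3
  obtain ⟨hV0, hK0, k, hk⟩ := h1
  have hk0 : 0 < k := (hK0 0).trans_le (hk 0)
  obtain ⟨C, hC, H⟩ := exists_lintegral_abs_sub_rpow_le hα hN
  obtain ⟨M, hM, HM⟩ := exists_lintegral_ballProb_sq_le hV hV0 0 one_pos
  have hp : 0 < critExp N α := by linarith [two_lt_critExp hα hN]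
  set p := critExp N α
  set I : ENNReal := ∫⁻ x, ENNReal.ofReal (K x) with hI
  set E : ℝ := √M + C with hE
  have hE0 : 0 < E := by positivity
  refine ⟨2 ^ p * (k * C + E ^ p * I.toReal), by positivity, fun u s hs hu hnorm => ?_⟩
  have hVu : ∫⁻ y, ENNReal.ofReal (V y * u y ^ 2) ≤ ENNReal.ofReal (s ^ 2) :=
    le_add_self.trans hnorm
  have hint := fun (x : EN N) (r : ℝ) (hr : 0 < r) =>
    integrable_ballProb hV hV0 hu (hVu.trans_lt ENNReal.ofReal_lt_top) x hr
  obtain ⟨c, hmc, hsob⟩ := H u s hs hu hint (le_self_add.trans hnorm)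
  have hm : |∫ y, u y ∂(ballProb (0 : EN N) 1)| ≤ √M * s := by
    have := isProbabilityMeasure_ballProb (0 : EN N) one_pos
    have h := ofReal_sq_integral_sub_le (hint 0 1 one_pos) 0
    simp only [sub_zero] at h
    have h' := (h.trans (HM u)).trans (mul_le_mul_right hVu _)
    rw [← ENNReal.ofReal_mul hM.le, ENNReal.ofReal_le_ofReal_iff (by positivity)] at h'
    refine abs_le_of_sq_le_sq ?_ (by positivity)
    rwa [mul_pow, Real.sq_sqrt hM.le]
  have hcE : |c| ≤ E * s := by
    have := abs_sub_abs_le_abs_sub c (∫ y, u y ∂(ballProb (0 : EN N) 1))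
    rw [abs_sub_comm] at this
    rw [hE, add_mul]
    linarith
  have hcI : ENNReal.ofReal (|c| ^ p) * I ≤ ENNReal.ofReal ((E * s) ^ p * I.toReal) := by
    rcases eq_or_ne c 0 with rfl | hc
    · simp [Real.zero_rpow hp.ne']
    have hIfin : I < ⊤ := lintegral_lt_top_of_ne_zero hK.measurable hu hK0 hk hp hc
      ((H₂ u s hnorm).trans_lt ENNReal.ofReal_lt_top) (hsob.trans_lt ENNReal.ofReal_lt_top)
    rw [ENNReal.ofReal_mul (by positivity), ENNReal.ofReal_toReal hIfin.ne]
    gcongr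
  have hpt : ∀ x, ENNReal.ofReal (K x * |u x| ^ p) ≤
      ENNReal.ofReal (2 ^ p) * (ENNReal.ofReal k * ENNReal.ofReal (|u x - c| ^ p) +
        ENNReal.ofReal (|c| ^ p) * ENNReal.ofReal (K x)) := fun x => by
    have hKx := hK0 x
    rw [← ENNReal.ofReal_mul hk0.le, ← ENNReal.ofReal_mul (by positivity),
      ← ENNReal.ofReal_add (by positivity) (by positivity), ← ENNReal.ofReal_mul (by positivity)]
    apply ENNReal.ofReal_le_ofReal
    have htri : |u x| ≤ |u x - c| + |c| := by
      simpa using abs_add_le (u x - c) c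
    calc K x * |u x| ^ p ≤ K x * (2 ^ p * (|u x - c| ^ p + |c| ^ p)) := by
          gcongr
          exact (Real.rpow_le_rpow (abs_nonneg _) htri hp.le).trans
            (add_rpow_le (abs_nonneg _) (abs_nonneg _) hp)
      _ = 2 ^ p * (K x * |u x - c| ^ p + |c| ^ p * K x) := by ring
      _ ≤ _ := by
          gcongr
          exact hk x
  calc ∫⁻ x, ENNReal.ofReal (K x * |u x| ^ p)
      ≤ ENNReal.ofReal (2 ^ p) * (ENNReal.ofReal k * (∫⁻ x, ENNReal.ofReal (|u x - c| ^ p)) +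
        ENNReal.ofReal (|c| ^ p) * I) := by
        rw [hI, ← lintegral_const_mul' _ _ ENNReal.ofReal_ne_top,
          ← lintegral_const_mul' _ _ ENNReal.ofReal_ne_top, ← lintegral_add_left (by fun_prop),
          ← lintegral_const_mul' _ _ ENNReal.ofReal_ne_top]
        exact lintegral_mono hpt
    _ ≤ ENNReal.ofReal (2 ^ p) * (ENNReal.ofReal k * ENNReal.ofReal (C * s ^ p) +
        ENNReal.ofReal ((E * s) ^ p * I.toReal)) := by
        gcongr
    _ = _ := by
        rw [← ENNReal.ofReal_mul hk0.le, ← ENNReal.ofReal_add (by positivity) (by positivity),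
          ← ENNReal.ofReal_mul (by positivity), Real.mul_rpow hE0.le hs.le]
        ring_nf

/-- The weighted estimate at the intermediate exponents. -/
lemma exists_rpow_lintegral_mul_rpow_le {N : ℕ} {α : ℝ} (hα : 0 < α) (hN : 2 * α < N)
    {V K : EN N → ℝ} (hV : Continuous V) (hK : Continuous K) (h1 : H1 V K) (h3 : H3 V K)
    {q : ℝ} (hq : 2 ≤ q) (hqp : q ≤ critExp N α) :
    ∃ C : ℝ, 0 < C ∧ ∀ (u : EN N → ℝ) (s : ℝ), 0 < s → Measurable u →
      normSq α V u ≤ ENNReal.ofReal (s ^ 2) →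
      (∫⁻ x, ENNReal.ofReal (K x * |u x| ^ q)) ^ (1 / q) ≤ ENNReal.ofReal (C * s) := by
  obtain ⟨A, hA, HA⟩ := exists_lintegral_mul_sq_le (α := α) h1 h3
  obtain ⟨B, hB, HB⟩ := exists_lintegral_mul_rpow_critExp_le hα hN hV hK h1 h3
  obtain ⟨-, hK0, -⟩ := h1
  have hq0 : 0 < q := by linarith
  refine ⟨(A + B) ^ (1 / q), by positivity, fun u s hs hu hnorm => ?_⟩
  have key : ∫⁻ x, ENNReal.ofReal (K x * |u x| ^ q) ≤ ENNReal.ofReal ((A + B) * s ^ q) :=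
    calc ∫⁻ x, ENNReal.ofReal (K x * |u x| ^ q)
        ≤ ENNReal.ofReal (s ^ (q - 2)) * (∫⁻ x, ENNReal.ofReal (K x * u x ^ 2)) +
          ENNReal.ofReal (s ^ (q - critExp N α)) *
            ∫⁻ x, ENNReal.ofReal (K x * |u x| ^ critExp N α) := by
          rw [← lintegral_const_mul' _ _ ENNReal.ofReal_ne_top,
            ← lintegral_const_mul' _ _ ENNReal.ofReal_ne_top, ← lintegral_add_left (by fun_prop)]
          refine lintegral_mono fun x => ?_
          have hKx := hK0 x
          rw [← ENNReal.ofReal_mul (by positivity), ← ENNReal.ofReal_mul (by positivity),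
            ← ENNReal.ofReal_add (by positivity) (by positivity)]
          apply ENNReal.ofReal_le_ofReal
          rw [← sq_abs (u x)]
          have := mul_le_mul_of_nonneg_left
            (rpow_le_interpolation hs (abs_nonneg (u x)) hq hqp) hKx.le
          linarith
      _ ≤ ENNReal.ofReal (s ^ (q - 2)) * ENNReal.ofReal (A * s ^ 2) +
          ENNReal.ofReal (s ^ (q - critExp N α)) * ENNReal.ofReal (B * s ^ critExp N α) := by
          gcongr
          · exact HA u s hnorm
          · exact HB u s hs hu hnorm
      _ = _ := by
          rw [← ENNReal.ofReal_mul (by positivity), ← ENNReal.ofReal_mul (by positivity),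
            ← ENNReal.ofReal_add (by positivity) (by positivity), mul_left_comm,
            mul_left_comm _ B, ← Real.rpow_two, ← Real.rpow_add hs, ← Real.rpow_add hs,
            sub_add_cancel, sub_add_cancel, add_mul]
  refine (ENNReal.rpow_le_rpow key (by positivity)).trans (le_of_eq ?_)
  rw [ENNReal.ofReal_rpow_of_pos (by positivity), Real.mul_rpow (by positivity) (by positivity),
    ← Real.rpow_mul hs.le, mul_one_div_cancel hq0.ne', Real.rpow_one]

end ZeroMass

/-- Lemma 2.1, case (h3): `X` embeds continuously into `L^q_K` for `q ∈ [2, 2*_α]`. -/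
theorem statement2 {N : ℕ} (α : ℝ) (hα : α ∈ Set.Ioo (0 : ℝ) 1) (hN : 2 * α < N)
    (V K : EN N → ℝ) (hV : Continuous V) (hK : Continuous K)
    (h1 : H1 V K) (h2 : H2 K) (h3 : H3 V K) :
    ∀ q : ℝ, 2 ≤ q → q ≤ critExp N α →
      ∃ C : ℝ, 0 < C ∧ ∀ u : EN N → ℝ, memX α V u →
        (∫⁻ x, ENNReal.ofReal (K x * |u x| ^ q)) ^ (1 / q) ≤
          ENNReal.ofReal (C * Xnorm α V u) := by
  intro q hq hqp
  obtain ⟨C, hC, H⟩ := exists_rpow_lintegral_mul_rpow_le hα.1 hN hV hK h1 h3 hq hqp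
  refine ⟨C, hC, fun u ⟨hu, hfin⟩ => ?_⟩
  have hX : 0 ≤ Xnorm α V u := Real.rpow_nonneg ENNReal.toReal_nonneg _
  have hsq : normSq α V u = ENNReal.ofReal (Xnorm α V u ^ 2) := by
    rw [Xnorm, ← Real.sqrt_eq_rpow, Real.sq_sqrt ENNReal.toReal_nonneg,
      ENNReal.ofReal_toReal hfin.ne]
  have hlim : Tendsto (fun s : ℝ => ENNReal.ofReal (C * s)) (nhdsWithin (Xnorm α V u)
      (Set.Ioi (Xnorm α V u))) (nhds (ENNReal.ofReal (C * Xnorm α V u))) :=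
    ((ENNReal.continuous_ofReal.comp (continuous_const_mul C)).tendsto _).mono_left
      nhdsWithin_le_nhds
  refine ge_of_tendsto hlim (eventually_nhdsWithin_of_forall fun s hs => ?_)
  have hs' : Xnorm α V u < s := hs
  refine H u s (hX.trans_lt hs') hu (hsq.trans_le (ENNReal.ofReal_le_ofReal ?_))
  gcongr
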